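/- Let (X,d) be a complete, locally compact length space and w: X → ℝ a bounded continuous function. Then the conformally transformed space (X, d') with d'(x,y) = inf_γ ∫₀¹ |γ̇_t| e^{w(γ_t)} dt is a complete geodesic space. -/

import Mathlib

open Filter MeasureTheory
open scoped Topology

/-- An absolutely continuous curve `γ : [0,1] → X` (w.r.t. a distance function `d`)
bundled with its metric speed `|γ̇_t| = lim_{h→0} d(γ(t+h), γ t)/|h|`. -/
structure ACWithSpeed (X : Type*) (d : X → X → ℝ) where
  toFun : ℝ → X
  speed : ℝ → ℝ
  speed_nonneg : ∀ t, 0 ≤ speed t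
  integrable : IntervalIntegrable speed volume 0 1
  speed_ae : ∀ᵐ t ∂(volume.restrict (Set.Ioo (0:ℝ) 1)),
    Filter.Tendsto (fun h : ℝ => d (toFun (t + h)) (toFun t) / |h|) (𝓝[≠] (0:ℝ))
      (𝓝 (speed t))
  dist_le : ∀ a b : ℝ, 0 ≤ a → a ≤ b → b ≤ 1 →
    d (toFun a) (toFun b) ≤ ∫ t in a..b, speed t

/-- The `e^w`-weighted length of an absolutely continuous curve. -/
noncomputable def wLength {X : Type*} (d : X → X → ℝ) (w : X → ℝ) (c : ACWithSpeed X d) : ℝ :=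
  ∫ t in (0:ℝ)..1, c.speed t * Real.exp (w (c.toFun t))

/-- The conformal distance with conformal factor `e^w`: infimum of `e^w`-weighted lengths
of absolutely continuous curves joining the two points. -/
noncomputable def confDist {X : Type*} (d : X → X → ℝ) (w : X → ℝ) (x y : X) : ℝ :=
  sInf { L | ∃ c : ACWithSpeed X d, c.toFun 0 = x ∧ c.toFun 1 = y ∧ L = wLength d w c }

/-- The intrinsic (length) distance induced by `d`. -/
noncomputable def lengthDist {X : Type*} (d : X → X → ℝ) (x y : X) : ℝ :=
  confDist d (fun _ => 0) x y

open Set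

/-- `γ` is an absolutely continuous curve on `[a, b]` with metric speed `v`. -/
structure IsACOn {X : Type*} [MetricSpace X] (γ : ℝ → X) (v : ℝ → ℝ) (a b : ℝ) : Prop where
  nonneg : ∀ t, 0 ≤ v t
  integrable : IntervalIntegrable v volume a b
  speed_ae : ∀ᵐ t, t ∈ Ioo a b →
    Tendsto (fun h : ℝ => dist (γ (t + h)) (γ t) / |h|) (𝓝[≠] 0) (𝓝 (v t))
  dist_le : ∀ s t, a ≤ s → s ≤ t → t ≤ b → dist (γ s) (γ t) ≤ ∫ u in s..t, v u

section Curves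

variable {X : Type*} [MetricSpace X] {γ γ₁ γ₂ : ℝ → X} {v v₁ v₂ : ℝ → ℝ} {a b c : ℝ}

theorem ACWithSpeed.isACOn (c : ACWithSpeed X (fun p q => dist p q)) :
    IsACOn c.toFun c.speed 0 1 where
  nonneg := c.speed_nonneg
  integrable := c.integrable
  speed_ae := (ae_restrict_iff' measurableSet_Ioo).1 c.speed_ae
  dist_le := c.dist_le

namespace IsACOn

theorem mono {s t : ℝ} (h : IsACOn γ v a b) (has : a ≤ s) (hst : s ≤ t) (htb : t ≤ b) :
    IsACOn γ v s t where
  nonneg := h.nonneg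
  integrable := h.integrable.mono_set (by
    rw [uIcc_of_le hst, uIcc_of_le (has.trans (hst.trans htb))]
    exact Icc_subset_Icc has htb)
  speed_ae := by
    filter_upwards [h.speed_ae] with u hu hu'
    exact hu (Ioo_subset_Ioo has htb hu')
  dist_le p q hp hpq hq := h.dist_le p q (has.trans hp) hpq (hq.trans htb)

theorem continuousOn (h : IsACOn γ v a b) (hab : a ≤ b) : ContinuousOn γ (Icc a b) := by
  have hF := intervalIntegral.continuousOn_primitive_interval' h.integrable left_mem_uIcc
  rw [uIcc_of_le hab] at hF
  have key : ∀ s ∈ Icc a b, ∀ t ∈ Icc a b,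
      dist (γ s) (γ t) ≤ dist (∫ u in a..s, v u) (∫ u in a..t, v u) := by
    have aux : ∀ s ∈ Icc a b, ∀ t ∈ Icc a b, s ≤ t →
        dist (γ s) (γ t) ≤ dist (∫ u in a..s, v u) (∫ u in a..t, v u) := by
      intro s hs t ht hst
      refine (h.dist_le s t hs.1 hst ht.2).trans ?_
      rw [dist_comm, Real.dist_eq, intervalIntegral.integral_interval_sub_left
        (h.mono le_rfl ht.1 ht.2).integrable (h.mono le_rfl hs.1 hs.2).integrable]
      exact le_abs_self _
    intro s hs t ht
    rcases le_total s t with hst | hst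
    · exact aux s hs t ht hst
    · rw [dist_comm, dist_comm (∫ u in a..s, v u)]
      exact aux t ht s hs hst
  intro t ht
  rw [ContinuousWithinAt, tendsto_iff_dist_tendsto_zero]
  refine squeeze_zero' (Eventually.of_forall fun _ => dist_nonneg) ?_
    (tendsto_iff_dist_tendsto_zero.1 (hF t ht))
  filter_upwards [self_mem_nhdsWithin] with s hs using key s hs t ht

theorem integrable_weight {f : X → ℝ} (hf : Continuous f) (h : IsACOn γ v a b) (hab : a ≤ b) :
    IntervalIntegrable (fun t => v t * Real.exp (f (γ t))) volume a b := by
  refine h.integrable.mul_continuousOn ?_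
  rw [uIcc_of_le hab]
  exact (Real.continuous_exp.comp hf).comp_continuousOn (h.continuousOn hab)

theorem glue (h₁ : IsACOn γ v a b) (h₂ : IsACOn γ v b c) : IsACOn γ v a c where
  nonneg := h₁.nonneg
  integrable := h₁.integrable.trans h₂.integrable
  speed_ae := by
    filter_upwards [h₁.speed_ae, h₂.speed_ae, Measure.ae_ne volume b] with t ht₁ ht₂ htb ht
    rcases lt_or_gt_of_ne htb with hlt | hlt
    · exact ht₁ ⟨ht.1, hlt⟩
    · exact ht₂ ⟨hlt, ht.2⟩
  dist_le s t hs hst ht := by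
    rcases le_total t b with htb | htb
    · exact h₁.dist_le s t hs hst htb
    rcases le_total b s with hbs | hbs
    · exact h₂.dist_le s t hbs hst ht
    rw [← intervalIntegral.integral_add_adjacent_intervals
      (h₁.mono hs hbs le_rfl).integrable (h₂.mono le_rfl htb ht).integrable]
    exact (dist_triangle _ (γ b) _).trans
      (add_le_add (h₁.dist_le s b hs hbs le_rfl) (h₂.dist_le b t le_rfl htb ht))

theorem congr (h : IsACOn γ₁ v₁ a b) (hγ : EqOn γ₁ γ₂ (Icc a b)) (hv : EqOn v₁ v₂ (Ioo a b))
    (hv₂ : ∀ t, 0 ≤ v₂ t) (hab : a ≤ b) :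
    IsACOn γ₂ v₂ a b where
  nonneg := hv₂
  integrable := h.integrable.congr_uIoo (by rwa [uIoo_of_le hab])
  speed_ae := by
    filter_upwards [h.speed_ae] with t ht ht'
    rw [← hv ht']
    refine (ht ht').congr' ?_
    have : ∀ᶠ s in 𝓝[≠] (0 : ℝ), t + s ∈ Ioo a b := by
      refine nhdsWithin_le_nhds ?_
      have : Tendsto (fun s : ℝ => t + s) (𝓝 0) (𝓝 t) := by
        simpa using (continuous_const_add t).tendsto 0
      exact this.eventually (Ioo_mem_nhds ht'.1 ht'.2)
    filter_upwards [this] with s hs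
    rw [hγ (Ioo_subset_Icc_self hs), hγ (Ioo_subset_Icc_self ht')]
  dist_le s t hs hst ht := by
    rw [← hγ ⟨hs, hst.trans ht⟩, ← hγ ⟨hs.trans hst, ht⟩]
    refine (h.dist_le s t hs hst ht).trans_eq ?_
    refine intervalIntegral.integral_congr_Ioo_of_le hst ?_
    exact hv.mono (Ioo_subset_Ioo hs ht)

theorem comp_affine {k : ℝ} (h : IsACOn γ v (k * a + c) (k * b + c)) (hk : 0 < k) :
    IsACOn (fun t => γ (k * t + c)) (fun t => k * v (k * t + c)) a b where
  nonneg t := mul_nonneg hk.le (h.nonneg _)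
  integrable := by
    refine IntervalIntegrable.const_mul ?_ k
    have := (h.integrable.comp_add_right c).comp_mul_left (c := k)
    simpa [hk.ne'] using this
  speed_ae := by
    have hq : Measure.QuasiMeasurePreserving (fun t : ℝ => k * t + c) volume volume :=
      (quasiMeasurePreserving_add_right volume c).comp
        (Measure.quasiMeasurePreserving_smul volume hk.ne')
    filter_upwards [hq.ae h.speed_ae] with t ht ht'
    have ht'' : k * t + c ∈ Ioo (k * a + c) (k * b + c) := by
      constructor <;> have := ht'.1 <;> have := ht'.2 <;> gcongr
    have hk0 : Tendsto (fun s : ℝ => k * s) (𝓝[≠] 0) (𝓝[≠] 0) := by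
      refine tendsto_nhdsWithin_iff.2 ⟨?_, ?_⟩
      · have : Tendsto (fun s : ℝ => k * s) (𝓝 0) (𝓝 0) := by
          simpa using (continuous_const_mul k).tendsto 0
        exact this.mono_left nhdsWithin_le_nhds
      · filter_upwards [self_mem_nhdsWithin] with s hs using mul_ne_zero hk.ne' hs
    refine (((ht ht'').comp hk0).const_mul k).congr fun s => ?_
    simp only [Function.comp_apply, abs_mul, abs_of_pos hk]
    rw [show k * (t + s) + c = k * t + c + k * s by ring, ← mul_div_assoc,
      mul_div_mul_left _ _ hk.ne']
  dist_le s t hs hst ht := by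
    rw [intervalIntegral.integral_const_mul, intervalIntegral.mul_integral_comp_mul_add]
    exact h.dist_le _ _ (by gcongr) (by gcongr) (by gcongr)


theorem const (x : X) : IsACOn (fun _ => x) (fun _ => 0) a b where
  nonneg _ := le_rfl
  integrable := intervalIntegrable_const
  speed_ae := by simp
  dist_le := by simp

/-- An absolutely continuous curve on `[0, 1]` with its metric speed, in bundled form. -/
def toACWithSpeed (h : IsACOn γ v 0 1) : ACWithSpeed X (fun p q => dist p q) where
  toFun := γ
  speed := v
  speed_nonneg := h.nonneg
  integrable := h.integrable
  speed_ae := (ae_restrict_iff' measurableSet_Ioo).2 h.speed_ae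
  dist_le := h.dist_le

theorem exp_mul_dist_le {f : X → ℝ} (hf : Continuous f) (h : IsACOn γ v a b) (hab : a ≤ b)
    {k : ℝ} (hk : ∀ t ∈ Icc a b, k ≤ f (γ t)) :
    Real.exp k * dist (γ a) (γ b) ≤ ∫ t in a..b, v t * Real.exp (f (γ t)) := by
  calc Real.exp k * dist (γ a) (γ b) ≤ Real.exp k * ∫ t in a..b, v t := by
        gcongr
        exact h.dist_le a b le_rfl hab le_rfl
    _ = ∫ t in a..b, v t * Real.exp k := by
        rw [intervalIntegral.integral_mul_const, mul_comm]
    _ ≤ _ := by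
        refine intervalIntegral.integral_mono_on hab (h.integrable.mul_const _)
          (h.integrable_weight hf hab) fun t ht => ?_
        have := h.nonneg t
        have := hk t ht
        gcongr

theorem weight_le {f : X → ℝ} (hf : Continuous f) (h : IsACOn γ v a b) (hab : a ≤ b)
    {k : ℝ} (hk : ∀ t ∈ Icc a b, f (γ t) ≤ k) :
    ∫ t in a..b, v t * Real.exp (f (γ t)) ≤ Real.exp k * ∫ t in a..b, v t := by
  rw [mul_comm, ← intervalIntegral.integral_mul_const]
  refine intervalIntegral.integral_mono_on hab (h.integrable_weight hf hab)
    (h.integrable.mul_const _) fun t ht => ?_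
  have := h.nonneg t
  have := hk t ht
  gcongr

end IsACOn

/-- The conformal distance of weight `e ^ w` over the distance of a metric space. -/
noncomputable abbrev conformalDist (w : X → ℝ) (x y : X) : ℝ :=
  confDist (fun p q : X => dist p q) w x y

theorem wLength_nonneg (w : X → ℝ) (c : ACWithSpeed X (fun p q => dist p q)) :
    0 ≤ wLength (fun p q => dist p q) w c :=
  intervalIntegral.integral_nonneg zero_le_one fun t _ =>
    mul_nonneg (c.speed_nonneg t) (Real.exp_nonneg _)

theorem conformalDist_le_wLength (w : X → ℝ) (c : ACWithSpeed X (fun p q => dist p q)) :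
    conformalDist w (c.toFun 0) (c.toFun 1) ≤ wLength (fun p q => dist p q) w c := by
  refine csInf_le ⟨0, ?_⟩ ⟨c, rfl, rfl, rfl⟩
  rintro L ⟨c', -, -, rfl⟩
  exact wLength_nonneg w c'

theorem conformalDist_self_le (w : X → ℝ) (x : X) : conformalDist w x x ≤ 0 := by
  have h := conformalDist_le_wLength w (IsACOn.const x).toACWithSpeed
  simpa [wLength, IsACOn.toACWithSpeed] using h

theorem IsACOn.conformalDist_le (w : X → ℝ) (h : IsACOn γ v a b) (hab : a ≤ b) :
    conformalDist w (γ a) (γ b) ≤ ∫ t in a..b, v t * Real.exp (w (γ t)) := by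
  rcases hab.eq_or_lt with rfl | hab
  · simpa using conformalDist_self_le w (γ a)
  have h' : IsACOn γ v ((b - a) * 0 + a) ((b - a) * 1 + a) := by simpa using h
  have key := conformalDist_le_wLength w (h'.comp_affine (sub_pos.2 hab)).toACWithSpeed
  simp only [wLength, IsACOn.toACWithSpeed, mul_assoc] at key
  rw [intervalIntegral.integral_const_mul, intervalIntegral.mul_integral_comp_mul_add
    (f := fun t => v t * Real.exp (w (γ t)))] at key
  simpa using key

/-- Any two points are joined by an absolutely continuous curve. -/
def IsACConnected (X : Type*) [MetricSpace X] : Prop :=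
  ∀ x y : X, ∃ c : ACWithSpeed X (fun p q => dist p q), c.toFun 0 = x ∧ c.toFun 1 = y

theorem isACConnected_of_lengthDist
    (hlen : ∀ a b : X, dist a b = lengthDist (fun p q => dist p q) a b) : IsACConnected X := by
  intro x y
  rcases eq_or_ne x y with rfl | hxy
  · exact ⟨(IsACOn.const x).toACWithSpeed, rfl, rfl⟩
  by_contra! hne
  refine hxy (dist_eq_zero.1 ?_)
  rw [hlen, lengthDist, confDist]
  convert Real.sInf_empty
  refine eq_empty_of_forall_notMem ?_
  rintro L ⟨c, h0, h1, -⟩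
  exact hne c h0 h1

theorem IsACConnected.exists_wLength_lt (hX : IsACConnected X) (w : X → ℝ) (x y : X) {ε : ℝ}
    (hε : 0 < ε) : ∃ c : ACWithSpeed X (fun p q => dist p q), c.toFun 0 = x ∧ c.toFun 1 = y ∧
      wLength (fun p q => dist p q) w c < conformalDist w x y + ε := by
  obtain ⟨c, h0, h1⟩ := hX x y
  obtain ⟨L, ⟨c', h0', h1', rfl⟩, hL⟩ := exists_lt_of_csInf_lt
    (s := {L | ∃ c : ACWithSpeed X (fun p q => dist p q),
      c.toFun 0 = x ∧ c.toFun 1 = y ∧ L = wLength (fun p q => dist p q) w c})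
    ⟨_, c, h0, h1, rfl⟩ (lt_add_of_pos_right (conformalDist w x y) hε)
  exact ⟨c', h0', h1', hL⟩

theorem IsACConnected.le_conformalDist (hX : IsACConnected X) {w : X → ℝ} {x y : X} {k : ℝ}
    (h : ∀ c : ACWithSpeed X (fun p q => dist p q), c.toFun 0 = x → c.toFun 1 = y →
      k ≤ wLength (fun p q => dist p q) w c) : k ≤ conformalDist w x y := by
  refine le_of_forall_pos_le_add fun ε hε => ?_
  obtain ⟨c, h0, h1, hc⟩ := hX.exists_wLength_lt w x y hε
  exact (h c h0 h1).trans hc.le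

theorem IsACConnected.conformalDist_triangle (hX : IsACConnected X) {w : X → ℝ}
    (hw : Continuous w) (x y z : X) :
    conformalDist w x z ≤ conformalDist w x y + conformalDist w y z := by
  refine le_of_forall_pos_le_add fun ε hε => ?_
  obtain ⟨c₁, rfl, rfl, hc₁⟩ := hX.exists_wLength_lt w x y (half_pos hε)
  obtain ⟨c₂, h0, rfl, hc₂⟩ := hX.exists_wLength_lt w (c₁.toFun 1) z (half_pos hε)
  set γ : ℝ → X := fun t => if t ≤ 1 then c₁.toFun t else c₂.toFun (t - 1) with hγ
  set v : ℝ → ℝ := fun t => if t ≤ 1 then c₁.speed t else c₂.speed (t - 1) with hv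
  have hv0 : ∀ t, 0 ≤ v t := fun t => by
    simp only [hv]
    split_ifs
    exacts [c₁.speed_nonneg _, c₂.speed_nonneg _]
  have hγ₁ : EqOn c₁.toFun γ (Icc 0 1) := fun t ht => by simp [hγ, ht.2]
  have hv₁ : EqOn c₁.speed v (Ioo 0 1) := fun t ht => by simp [hv, ht.2.le]
  have hγ₂ : EqOn (fun t => c₂.toFun (t - 1)) γ (Icc 1 2) := fun t ht => by
    rcases ht.1.eq_or_lt with rfl | hlt
    · simp [hγ, h0]
    · simp [hγ, hlt.not_ge]
  have hv₂ : EqOn (fun t => c₂.speed (t - 1)) v (Ioo 1 2) := fun t ht => by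
    simp [hv, ht.1.not_ge]
  have h₁ : IsACOn γ v 0 1 := c₁.isACOn.congr hγ₁ hv₁ hv0 zero_le_one
  have h₂' : IsACOn (fun t => c₂.toFun (t - 1)) (fun t => c₂.speed (t - 1)) 1 2 := by
    have : IsACOn c₂.toFun c₂.speed (1 * 1 + -1) (1 * 2 + -1) := by
      convert c₂.isACOn using 1 <;> norm_num
    simpa [← sub_eq_add_neg] using this.comp_affine one_pos
  have h₂ : IsACOn γ v 1 2 := h₂'.congr hγ₂ hv₂ hv0 one_le_two
  have key := (h₁.glue h₂).conformalDist_le w zero_le_two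
  rw [← intervalIntegral.integral_add_adjacent_intervals
    (h₁.integrable_weight hw zero_le_one) (h₂.integrable_weight hw one_le_two)] at key
  have e₁ : ∫ t in (0 : ℝ)..1, v t * Real.exp (w (γ t)) =
      wLength (fun p q => dist p q) w c₁ := by
    refine intervalIntegral.integral_congr_Ioo_of_le zero_le_one fun t ht => ?_
    simp only [← hv₁ ht, ← hγ₁ (Ioo_subset_Icc_self ht)]
  have e₂ : ∫ t in (1 : ℝ)..2, v t * Real.exp (w (γ t)) =
      wLength (fun p q => dist p q) w c₂ := by
    have : ∫ t in (1 : ℝ)..2, v t * Real.exp (w (γ t)) =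
        ∫ t in (1 : ℝ)..2, c₂.speed (t - 1) * Real.exp (w (c₂.toFun (t - 1))) := by
      refine intervalIntegral.integral_congr_Ioo_of_le one_le_two fun t ht => ?_
      simp only [← hv₂ ht, ← hγ₂ (Ioo_subset_Icc_self ht)]
    rw [this, intervalIntegral.integral_comp_sub_right
      (fun t => c₂.speed t * Real.exp (w (c₂.toFun t)))]
    norm_num [wLength]
  have g0 : γ 0 = c₁.toFun 0 := by simp [hγ]
  have g2 : γ 2 = c₂.toFun 1 := by norm_num [hγ]
  rw [e₁, e₂, g0, g2] at key
  linarith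

theorem IsACConnected.exp_mul_dist_le_conformalDist (hX : IsACConnected X) {w : X → ℝ}
    (hw : Continuous w) {m : ℝ} (hm : ∀ x, m ≤ w x) (x y : X) :
    Real.exp m * dist x y ≤ conformalDist w x y := by
  refine hX.le_conformalDist ?_
  rintro c rfl rfl
  exact c.isACOn.exp_mul_dist_le hw zero_le_one fun t _ => hm _

/-- The distance of `X` is the infimum of the lengths of absolutely continuous curves. -/
def HasCurvesOfNearlyMinimalLength (X : Type*) [MetricSpace X] : Prop :=
  ∀ (x y : X) (ε : ℝ), 0 < ε → ∃ c : ACWithSpeed X (fun p q => dist p q),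
    c.toFun 0 = x ∧ c.toFun 1 = y ∧ ∫ t in (0 : ℝ)..1, c.speed t < dist x y + ε

theorem hasCurvesOfNearlyMinimalLength_of_lengthDist
    (hlen : ∀ a b : X, dist a b = lengthDist (fun p q => dist p q) a b) :
    HasCurvesOfNearlyMinimalLength X := by
  intro x y ε hε
  obtain ⟨c, h0, h1, hc⟩ :=
    (isACConnected_of_lengthDist hlen).exists_wLength_lt (fun _ => 0) x y hε
  refine ⟨c, h0, h1, ?_⟩
  rw [hlen x y]
  simpa [wLength, lengthDist] using hc

namespace HasCurvesOfNearlyMinimalLength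

theorem isACConnected (hX : HasCurvesOfNearlyMinimalLength X) : IsACConnected X := fun x y =>
  let ⟨c, h0, h1, _⟩ := hX x y 1 one_pos
  ⟨c, h0, h1⟩

theorem exists_between (hX : HasCurvesOfNearlyMinimalLength X) (x y : X) {r ε : ℝ} (hr : 0 ≤ r)
    (hrd : r ≤ dist x y) (hε : 0 < ε) :
    ∃ z, dist x z ≤ r ∧ dist z y ≤ dist x y - r + ε := by
  obtain ⟨c, rfl, rfl, hc⟩ := hX x y ε hε
  have hF := intervalIntegral.continuousOn_primitive_interval' c.integrable left_mem_uIcc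
  rw [uIcc_of_le zero_le_one] at hF
  obtain ⟨t, ht, htr⟩ := intermediate_value_Icc zero_le_one hF
    (show r ∈ Icc _ _ by
      simpa using ⟨hr, hrd.trans (c.dist_le 0 1 le_rfl zero_le_one le_rfl)⟩)
  simp only at htr
  have hsum := intervalIntegral.integral_add_adjacent_intervals
    (c.isACOn.mono le_rfl ht.1 ht.2).integrable (c.isACOn.mono ht.1 ht.2 le_rfl).integrable
  have h₁ := c.dist_le 0 t le_rfl ht.1 ht.2
  have h₂ := c.dist_le t 1 ht.1 ht.2 le_rfl
  exact ⟨c.toFun t, by linarith, by linarith⟩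

theorem isCompact_closedBall_of_forall_lt [CompleteSpace X]
    (hX : HasCurvesOfNearlyMinimalLength X) {x : X} {R : ℝ} (hR : 0 < R)
    (h : ∀ r, 0 ≤ r → r < R → IsCompact (Metric.closedBall x r)) :
    IsCompact (Metric.closedBall x R) := by
  refine isCompact_iff_totallyBounded_isComplete.2 ⟨?_, Metric.isClosed_closedBall.isComplete⟩
  refine Metric.totallyBounded_iff.2 fun ε hε => ?_
  set r := max 0 (R - ε / 4) with hr
  have hr0 : 0 ≤ r := le_max_left _ _
  have hrR : r < R := max_lt hR (by linarith)
  obtain ⟨T, hT, hcov⟩ := Metric.totallyBounded_iff.1 (h r hr0 hrR).totallyBounded (ε / 4)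
    (by linarith)
  refine ⟨T, hT, fun y hy => ?_⟩
  rw [Metric.mem_closedBall'] at hy
  obtain ⟨z, hxz, hzy⟩ : ∃ z, dist x z ≤ r ∧ dist z y ≤ ε / 2 := by
    rcases le_total (dist x y) r with hle | hle
    · exact ⟨y, hle, by simpa using by positivity⟩
    · obtain ⟨z, h₁, h₂⟩ := hX.exists_between x y hr0 hle (show 0 < ε / 4 by linarith)
      exact ⟨z, h₁, by linarith [le_max_right 0 (R - ε / 4)]⟩
  obtain ⟨p, hp, hzp⟩ := mem_iUnion₂.1 (hcov (Metric.mem_closedBall'.2 hxz))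
  refine mem_iUnion₂.2 ⟨p, hp, ?_⟩
  rw [Metric.mem_ball] at hzp ⊢
  linarith [dist_triangle y z p, dist_comm y z]

theorem exists_isCompact_closedBall_add [LocallyCompactSpace X]
    (hX : HasCurvesOfNearlyMinimalLength X) {x : X} {r : ℝ} (hr : 0 ≤ r)
    (h : IsCompact (Metric.closedBall x r)) :
    ∃ δ > 0, IsCompact (Metric.closedBall x (r + δ)) := by
  obtain ⟨K, hK, hsub⟩ := exists_compact_superset h
  obtain ⟨δ, hδ, hδK⟩ := h.exists_cthickening_subset_open isOpen_interior hsub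
  refine ⟨δ / 2, half_pos hδ, hK.of_isClosed_subset Metric.isClosed_closedBall fun y hy => ?_⟩
  rw [Metric.mem_closedBall'] at hy
  refine interior_subset (hδK ?_)
  rcases le_total (dist x y) r with hle | hle
  · exact Metric.self_subset_cthickening _ (Metric.mem_closedBall'.2 hle)
  · obtain ⟨z, h₁, h₂⟩ := hX.exists_between x y hr hle (half_pos hδ)
    refine Metric.mem_cthickening_of_dist_le y z _ _ (Metric.mem_closedBall'.2 h₁) ?_
    linarith [dist_comm y z]

/-- Hopf-Rinow: a complete, locally compact length space is proper. -/
theorem properSpace [CompleteSpace X] [LocallyCompactSpace X]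
    (hX : HasCurvesOfNearlyMinimalLength X) : ProperSpace X := by
  refine ⟨fun x R => ?_⟩
  rcases lt_or_ge R 0 with hR | hR
  · simp [Metric.closedBall_eq_empty.2 hR]
  set S := {r | IsCompact (Metric.closedBall x r)} with hS
  have hdown : ∀ r ∈ S, ∀ s ≤ r, s ∈ S := fun r hr s hs =>
    hr.of_isClosed_subset Metric.isClosed_closedBall (Metric.closedBall_subset_closedBall hs)
  have h0 : (0 : ℝ) ∈ S := by simp [hS]
  refine IsClosed.Icc_subset_of_forall_exists_gt (s := S) (a := 0) (b := R) ?_ h0 ?_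
    ⟨hR, le_rfl⟩
  · refine isClosed_of_closure_subset fun r hr => ?_
    have hrI : r ∈ Icc 0 R := closure_minimal inter_subset_right isClosed_Icc hr
    refine ⟨?_, hrI⟩
    rcases hrI.1.eq_or_lt with rfl | hpos
    · exact h0
    refine hX.isCompact_closedBall_of_forall_lt hpos fun s _ hsr => ?_
    obtain ⟨p, hps, hp⟩ := mem_closure_iff.1 hr (Ioi s) isOpen_Ioi hsr
    exact hdown p hp.1 s (le_of_lt hps)
  · rintro r ⟨hr, hrI⟩ y hy
    obtain ⟨δ, hδ, hc⟩ := hX.exists_isCompact_closedBall_add hrI.1 hr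
    refine ⟨min (r + δ) y, hdown _ hc _ (min_le_left _ _), ?_, min_le_right _ _⟩
    exact lt_min (by linarith) hy

theorem conformalDist_le_of_ball (hX : HasCurvesOfNearlyMinimalLength X) {w : X → ℝ}
    (hw : Continuous w) {x y : X} {r k : ℝ} (hxy : dist x y < r)
    (hk : ∀ z, dist x z < r → w z ≤ k) :
    conformalDist w x y ≤ Real.exp k * dist x y := by
  have key : ∀ ε, 0 < ε → ε ≤ r - dist x y →
      conformalDist w x y ≤ Real.exp k * (dist x y + ε) := by
    intro ε hε hεr
    obtain ⟨c, rfl, rfl, hc⟩ := hX x y ε hε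
    refine (conformalDist_le_wLength w c).trans
      ((c.isACOn.weight_le hw zero_le_one fun t ht => hk _ ?_).trans (by gcongr))
    have hsum := intervalIntegral.integral_add_adjacent_intervals
      (c.isACOn.mono le_rfl ht.1 ht.2).integrable (c.isACOn.mono ht.1 ht.2 le_rfl).integrable
    have h₁ := c.dist_le 0 t le_rfl ht.1 ht.2
    have h₂ := dist_nonneg.trans (c.dist_le t 1 ht.1 ht.2 le_rfl)
    linarith
  have hlim : Tendsto (fun ε => Real.exp k * (dist x y + ε)) (𝓝[>] 0)
      (𝓝 (Real.exp k * dist x y)) := by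
    have : Continuous fun ε : ℝ => Real.exp k * (dist x y + ε) := by fun_prop
    simpa using (this.tendsto 0).mono_left nhdsWithin_le_nhds
  refine ge_of_tendsto hlim ?_
  filter_upwards [Ioc_mem_nhdsGT (sub_pos.2 hxy)] with ε hε using key ε hε.1 hε.2

theorem conformalDist_le_exp_mul_dist (hX : HasCurvesOfNearlyMinimalLength X) {w : X → ℝ}
    (hw : Continuous w) {M : ℝ} (hM : ∀ x, w x ≤ M) (x y : X) :
    conformalDist w x y ≤ Real.exp M * dist x y :=
  hX.conformalDist_le_of_ball hw (lt_add_one _) fun z _ => hM z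

/-- Near each point the conformal distance is comparable to `e ^ w` times the distance. -/
theorem exists_ball_conformalDist_bounds (hX : HasCurvesOfNearlyMinimalLength X) {w : X → ℝ}
    (hw : Continuous w) {m : ℝ} (hm : ∀ x, m ≤ w x) (p : X) {ε : ℝ} (hε : 0 < ε) :
    ∃ δ > 0, ∀ x ∈ Metric.ball p δ, ∀ y ∈ Metric.ball p δ,
      Real.exp (w p - ε) * dist x y ≤ conformalDist w x y ∧
        conformalDist w x y ≤ Real.exp (w p + ε) * dist x y := by
  obtain ⟨r, hr, hball⟩ := Metric.continuous_iff.1 hw p ε hε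
  have hwr : ∀ z, dist p z < r → w p - ε ≤ w z ∧ w z ≤ w p + ε := fun z hz => by
    have := abs_lt.1 (Real.dist_eq (w z) (w p) ▸ hball z (by rwa [dist_comm]))
    constructor <;> linarith
  set A := Real.exp (w p - ε) with hA
  set B := Real.exp m with hB
  have hA0 : 0 < A := Real.exp_pos _
  have hB0 : 0 < B := Real.exp_pos _
  refine ⟨min (r / 4) (r * B / (B + 2 * A)), by positivity, fun x hx y hy => ?_⟩
  rw [Metric.mem_ball'] at hx hy
  obtain ⟨hx₁, hx₂⟩ := lt_min_iff.1 hx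
  obtain ⟨hy₁, hy₂⟩ := lt_min_iff.1 hy
  rw [lt_div_iff₀ (by positivity)] at hx₂ hy₂
  have hxy : dist x y ≤ dist p x + dist p y := dist_comm p x ▸ dist_triangle x p y
  constructor
  · refine hX.isACConnected.le_conformalDist ?_
    rintro c rfl rfl
    by_cases hc : ∀ t ∈ Icc (0 : ℝ) 1, dist p (c.toFun t) < r
    · exact c.isACOn.exp_mul_dist_le hw zero_le_one fun t ht => (hwr _ (hc t ht)).1
    push Not at hc
    obtain ⟨t, ht, hrt⟩ := hc
    have hI := intervalIntegral.integral_add_adjacent_intervals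
      ((c.isACOn.mono le_rfl ht.1 ht.2).integrable_weight hw ht.1)
      ((c.isACOn.mono ht.1 ht.2 le_rfl).integrable_weight hw ht.2)
    have h₁ := (c.isACOn.mono le_rfl ht.1 ht.2).exp_mul_dist_le hw ht.1 fun t _ => hm _
    have h₂ := (c.isACOn.mono ht.1 ht.2 le_rfl).exp_mul_dist_le hw ht.2 fun t _ => hm _
    have h₃ : 0 ≤ Real.exp m * dist (c.toFun t) (c.toFun 1) := by positivity
    have h₄ : r - dist p (c.toFun 0) ≤ dist (c.toFun 0) (c.toFun t) := by
      linarith [dist_triangle p (c.toFun 0) (c.toFun t)]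
    have h₅ := mul_le_mul_of_nonneg_left h₄ hB0.le
    have h₆ := mul_le_mul_of_nonneg_left hxy hA0.le
    change _ ≤ ∫ t in (0 : ℝ)..1, c.speed t * Real.exp (w (c.toFun t))
    nlinarith
  · refine hX.conformalDist_le_of_ball hw (r := r / 2) (by linarith) fun z hz => (hwr z ?_).2
    linarith [dist_triangle p x z]

end HasCurvesOfNearlyMinimalLength

/-- A curve can be reparametrized so that its conformal arcs grow at most linearly. -/
theorem exists_reparametrization {w : X → ℝ} (hw : Continuous w)
    (c : ACWithSpeed X (fun p q => dist p q)) :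
    ∃ f : ℝ → X, f 0 = c.toFun 0 ∧ f 1 = c.toFun 1 ∧ ∀ s t, 0 ≤ s → s ≤ t → t ≤ 1 →
      conformalDist w (f s) (f t) ≤ wLength (fun p q => dist p q) w c * (t - s) := by
  set ℓ := wLength (fun p q => dist p q) w c with hℓ
  set F : ℝ → ℝ := fun t => ∫ u in (0 : ℝ)..t, c.speed u * Real.exp (w (c.toFun u)) with hF
  have hℓ0 : 0 ≤ ℓ := wLength_nonneg w c
  have hF0 : F 0 = 0 := by simp [hF]
  have hF1 : F 1 = ℓ := rfl
  have hFc : ContinuousOn F (Icc 0 1) := by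
    have := intervalIntegral.continuousOn_primitive_interval'
      (c.isACOn.integrable_weight hw zero_le_one) left_mem_uIcc
    rwa [uIcc_of_le zero_le_one] at this
  have hsub : ∀ s t, 0 ≤ s → s ≤ t → t ≤ 1 →
      ∫ u in s..t, c.speed u * Real.exp (w (c.toFun u)) = F t - F s := fun s t hs hst ht =>
    (intervalIntegral.integral_interval_sub_left
      ((c.isACOn.mono le_rfl (hs.trans hst) ht).integrable_weight hw (hs.trans hst))
      ((c.isACOn.mono le_rfl hs (hst.trans ht)).integrable_weight hw hs)).symm
  have hle : ∀ s t, 0 ≤ s → s ≤ t → t ≤ 1 →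
      conformalDist w (c.toFun s) (c.toFun t) ≤ F t - F s := fun s t hs hst ht =>
    hsub s t hs hst ht ▸ (c.isACOn.mono hs hst ht).conformalDist_le w hst
  have hmono : ∀ s t, 0 ≤ s → s ≤ t → t ≤ 1 → F s ≤ F t := fun s t hs hst ht => by
    rw [← sub_nonneg, ← hsub s t hs hst ht]
    exact intervalIntegral.integral_nonneg hst fun u _ =>
      mul_nonneg (c.speed_nonneg u) (Real.exp_nonneg _)
  have heq_of_le : ∀ s t, 0 ≤ s → s ≤ t → t ≤ 1 → F s = F t → c.toFun s = c.toFun t := by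
    intro s t hs hst ht hst'
    have hca := (c.isACOn.mono hs hst ht).continuousOn hst
    obtain ⟨q, -, hq⟩ := isCompact_Icc.exists_isMinOn (nonempty_Icc.2 hst)
      (hw.comp_continuousOn hca)
    have := (c.isACOn.mono hs hst ht).exp_mul_dist_le hw hst fun u hu => hq hu
    rw [hsub s t hs hst ht, hst', sub_self] at this
    exact dist_le_zero.1 (nonpos_of_mul_nonpos_right this (Real.exp_pos _))
  have heq : ∀ s ∈ Icc (0 : ℝ) 1, ∀ t ∈ Icc (0 : ℝ) 1, F s = F t → c.toFun s = c.toFun t := by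
    intro s hs t ht hst
    rcases le_total s t with h | h
    · exact heq_of_le s t hs.1 h ht.2 hst
    · exact (heq_of_le t s ht.1 h hs.2 hst.symm).symm
  have hτ : ∀ s : ℝ, ∃ u, s ∈ Icc (0 : ℝ) 1 → u ∈ Icc (0 : ℝ) 1 ∧ F u = ℓ * s := by
    intro s
    by_cases hs : s ∈ Icc (0 : ℝ) 1
    · obtain ⟨u, hu, hu'⟩ := intermediate_value_Icc zero_le_one hFc
        (show ℓ * s ∈ Icc (F 0) (F 1) by
          rw [hF0, hF1]
          exact ⟨mul_nonneg hℓ0 hs.1, mul_le_of_le_one_right hℓ0 hs.2⟩)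
      exact ⟨u, fun _ => ⟨hu, hu'⟩⟩
    · exact ⟨0, fun h => absurd h hs⟩
  choose τ hτ using hτ
  refine ⟨fun s => c.toFun (τ s), ?_, ?_, fun s t hs hst ht => ?_⟩
  · obtain ⟨h, h'⟩ := hτ 0 (by simp)
    exact heq _ h _ (by simp) (by simp [h', hF0])
  · obtain ⟨h, h'⟩ := hτ 1 (by simp)
    exact heq _ h _ (by simp) (by simp [h', hF1])
  · obtain ⟨hs₁, hs₂⟩ := hτ s ⟨hs, hst.trans ht⟩
    obtain ⟨ht₁, ht₂⟩ := hτ t ⟨hs.trans hst, ht⟩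
    rw [mul_sub, ← hs₂, ← ht₂]
    have hst' : F (τ s) ≤ F (τ t) := by
      rw [hs₂, ht₂]
      gcongr
    rcases le_total (τ s) (τ t) with h | h
    · exact hle _ _ hs₁.1 h ht₁.2
    · have h' := hst'.antisymm (hmono _ _ ht₁.1 h hs₁.2)
      simp only [heq _ hs₁ _ ht₁ h', h', sub_self]
      exact conformalDist_self_le w _

namespace HasCurvesOfNearlyMinimalLength

/-- A shortest path for the conformal distance, parametrized proportionally to arc length. -/
theorem exists_geodesic [CompleteSpace X] [LocallyCompactSpace X]
    (hX : HasCurvesOfNearlyMinimalLength X) {w : X → ℝ} (hw : Continuous w) {m M : ℝ}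
    (hm : ∀ x, m ≤ w x) (hM : ∀ x, w x ≤ M) (a b : X) :
    ∃ g : ℝ → X, g 0 = a ∧ g 1 = b ∧ ∀ s t, 0 ≤ s → s ≤ t → t ≤ 1 →
      conformalDist w (g s) (g t) = conformalDist w a b * (t - s) := by
  have := hX.properSpace
  set L := conformalDist w a b with hL
  have hf : ∀ n : ℕ, ∃ f : ℝ → X, f 0 = a ∧ f 1 = b ∧ ∀ s t, 0 ≤ s → s ≤ t → t ≤ 1 →
      conformalDist w (f s) (f t) ≤ (L + 1 / ((n : ℝ) + 1)) * (t - s) := by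
    intro n
    obtain ⟨c, h0, h1, hc⟩ := hX.isACConnected.exists_wLength_lt w a b
      (Nat.one_div_pos_of_nat (α := ℝ) (n := n))
    obtain ⟨f, hf0, hf1, hf⟩ := exists_reparametrization hw c
    refine ⟨f, hf0.trans h0, hf1.trans h1, fun s t hs hst ht => (hf s t hs hst ht).trans ?_⟩
    exact mul_le_mul_of_nonneg_right hc.le (sub_nonneg.2 hst)
  choose f hf0 hf1 hf using hf
  set U : Ultrafilter ℕ := hyperfilter ℕ with hU
  have hlim : ∀ s : ℝ, ∃ z, s ∈ Icc (0 : ℝ) 1 → Tendsto (fun n => f n s) U (𝓝 z) := by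
    intro s
    by_cases hs : s ∈ Icc (0 : ℝ) 1
    · have hmem : ∀ n, f n s ∈ Metric.closedBall a ((L + 1) / Real.exp m) := by
        intro n
        rw [Metric.mem_closedBall', le_div_iff₀ (Real.exp_pos _), mul_comm]
        refine (hX.isACConnected.exp_mul_dist_le_conformalDist hw hm _ _).trans ?_
        have h := hf n 0 s le_rfl hs.1 hs.2
        rw [hf0] at h
        have hL0 : 0 ≤ L := le_trans (by positivity)
          (hX.isACConnected.exp_mul_dist_le_conformalDist hw hm a b)
        have hn : 1 / ((n : ℝ) + 1) ≤ 1 := by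
          rw [div_le_one (by positivity)]
          linarith [n.cast_nonneg (α := ℝ)]
        have hn0 : 0 ≤ 1 / ((n : ℝ) + 1) := by positivity
        nlinarith [hs.1, hs.2]
      obtain ⟨z, -, hz⟩ := (isCompact_closedBall a ((L + 1) / Real.exp m)).ultrafilter_le_nhds'
        (U.map fun n => f n s) (Ultrafilter.mem_map.2 (univ_mem' hmem))
      exact ⟨z, fun _ => hz⟩
    · exact ⟨a, fun h => absurd h hs⟩
  choose g hg using hlim
  have hg0 : g 0 = a := tendsto_nhds_unique (hg 0 (by simp)) (by simp [hf0])
  have hg1 : g 1 = b := tendsto_nhds_unique (hg 1 (by simp)) (by simp [hf1])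
  have hle : ∀ s t, 0 ≤ s → s ≤ t → t ≤ 1 → conformalDist w (g s) (g t) ≤ L * (t - s) := by
    intro s t hs hst ht
    have hgs := hg s ⟨hs, hst.trans ht⟩
    have hgt := hg t ⟨hs.trans hst, ht⟩
    have hn : Tendsto (fun n : ℕ => 1 / ((n : ℝ) + 1)) U (𝓝 0) :=
      tendsto_one_div_add_atTop_nhds_zero_nat.mono_left Nat.hyperfilter_le_atTop
    have hT := (((tendsto_const_nhds (x := g s)).dist hgs).const_mul (Real.exp M)).add
      (((hn.const_add L).mul_const (t - s)).add
        ((hgt.dist (tendsto_const_nhds (x := g t))).const_mul (Real.exp M)))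
    simp only [dist_self, mul_zero, add_zero, zero_add] at hT
    refine ge_of_tendsto' hT fun n => ?_
    have hC := hX.isACConnected
    have h₁ := hC.conformalDist_triangle hw (g s) (f n s) (g t)
    have h₂ := hC.conformalDist_triangle hw (f n s) (f n t) (g t)
    have h₃ := hX.conformalDist_le_exp_mul_dist hw hM (g s) (f n s)
    have h₄ := hX.conformalDist_le_exp_mul_dist hw hM (f n t) (g t)
    have h₅ := hf n s t hs hst ht
    linarith
  refine ⟨g, hg0, hg1, fun s t hs hst ht => (hle s t hs hst ht).antisymm ?_⟩
  have hC := hX.isACConnected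
  have h₁ := hC.conformalDist_triangle hw (g 0) (g s) (g 1)
  have h₂ := hC.conformalDist_triangle hw (g s) (g t) (g 1)
  have h₃ := hle 0 s le_rfl hs (hst.trans ht)
  have h₄ := hle t 1 (hs.trans hst) ht le_rfl
  have h₅ : conformalDist w (g 0) (g 1) = L := by rw [hg0, hg1]
  linarith

end HasCurvesOfNearlyMinimalLength

/-- The speed of a curve of constant conformal speed `L` is `L * e ^ (-w)`. -/
theorem tendsto_dist_div_of_conformalDist_eq {w : X → ℝ} {γ : ℝ → X} {S : Set ℝ} {t L : ℝ}
    (ht : t ∈ S) (hγ : ContinuousWithinAt γ S t)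
    (hbounds : ∀ ε > 0, ∃ δ > 0, ∀ x ∈ Metric.ball (γ t) δ, ∀ y ∈ Metric.ball (γ t) δ,
      Real.exp (w (γ t) - ε) * dist x y ≤ conformalDist w x y ∧
        conformalDist w x y ≤ Real.exp (w (γ t) + ε) * dist x y)
    (hgeo : ∀ s ∈ S, ∀ u ∈ S, s ≤ u → conformalDist w (γ s) (γ u) = L * (u - s)) :
    Tendsto (fun s => dist (γ s) (γ t) / |s - t|) (𝓝[S \ {t}] t)
      (𝓝 (L * Real.exp (-w (γ t)))) := by
  have key : ∀ ε > 0, ∀ᶠ s in 𝓝[S \ {t}] t,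
      L * Real.exp (-w (γ t) - ε) ≤ dist (γ s) (γ t) / |s - t| ∧
        dist (γ s) (γ t) / |s - t| ≤ L * Real.exp (-w (γ t) + ε) := by
    intro ε hε
    obtain ⟨δ, hδ, hball⟩ := hbounds ε hε
    have hnear := (hγ.mono (sdiff_subset (t := {t}))).eventually (Metric.ball_mem_nhds (γ t) hδ)
    filter_upwards [hnear, self_mem_nhdsWithin] with s hs hsS
    have hpos : 0 < |s - t| := abs_pos.2 (sub_ne_zero.2 hsS.2)
    have htb := Metric.mem_ball_self (x := γ t) hδ
    have hmain : Real.exp (w (γ t) - ε) * dist (γ s) (γ t) ≤ L * |s - t| ∧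
        L * |s - t| ≤ Real.exp (w (γ t) + ε) * dist (γ s) (γ t) := by
      rcases le_total s t with hst | hst
      · rw [abs_sub_comm, abs_of_nonneg (sub_nonneg.2 hst), ← hgeo s hsS.1 t ht hst]
        exact hball _ hs _ htb
      · rw [abs_of_nonneg (sub_nonneg.2 hst), ← hgeo t ht s hsS.1 hst, dist_comm]
        exact hball _ htb _ hs
    have e₁ : Real.exp (-w (γ t) - ε) * Real.exp (w (γ t) + ε) = 1 := by
      rw [← Real.exp_add]
      simp
    have e₂ : Real.exp (-w (γ t) + ε) * Real.exp (w (γ t) - ε) = 1 := by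
      rw [← Real.exp_add]
      simp
    rw [le_div_iff₀ hpos, div_le_iff₀ hpos]
    constructor
    · calc L * Real.exp (-w (γ t) - ε) * |s - t|
        _ = Real.exp (-w (γ t) - ε) * (L * |s - t|) := by ring
        _ ≤ Real.exp (-w (γ t) - ε) * (Real.exp (w (γ t) + ε) * dist (γ s) (γ t)) :=
          mul_le_mul_of_nonneg_left hmain.2 (Real.exp_nonneg _)
        _ = dist (γ s) (γ t) := by rw [← mul_assoc, e₁, one_mul]
    · calc dist (γ s) (γ t)
        _ = Real.exp (-w (γ t) + ε) * (Real.exp (w (γ t) - ε) * dist (γ s) (γ t)) := by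
          rw [← mul_assoc, e₂, one_mul]
        _ ≤ Real.exp (-w (γ t) + ε) * (L * |s - t|) :=
          mul_le_mul_of_nonneg_left hmain.1 (Real.exp_nonneg _)
        _ = L * Real.exp (-w (γ t) + ε) * |s - t| := by ring
  have hlow : Tendsto (fun ε => L * Real.exp (-w (γ t) - ε)) (𝓝[>] 0)
      (𝓝 (L * Real.exp (-w (γ t)))) := by
    have : Continuous fun ε => L * Real.exp (-w (γ t) - ε) := by fun_prop
    simpa using (this.tendsto 0).mono_left nhdsWithin_le_nhds
  have hupp : Tendsto (fun ε => L * Real.exp (-w (γ t) + ε)) (𝓝[>] 0)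
      (𝓝 (L * Real.exp (-w (γ t)))) := by
    have : Continuous fun ε => L * Real.exp (-w (γ t) + ε) := by fun_prop
    simpa using (this.tendsto 0).mono_left nhdsWithin_le_nhds
  refine tendsto_order.2 ⟨fun p hp => ?_, fun p hp => ?_⟩
  · obtain ⟨ε, hε, hε0⟩ := ((hlow.eventually (lt_mem_nhds hp)).and self_mem_nhdsWithin).exists
    filter_upwards [key ε hε0] with s hs using hε.trans_le hs.1
  · obtain ⟨ε, hε, hε0⟩ := ((hupp.eventually (gt_mem_nhds hp)).and self_mem_nhdsWithin).exists
    filter_upwards [key ε hε0] with s hs using hs.2.trans_lt hε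

/-- A continuous curve with continuous metric speed is absolutely continuous. -/
theorem isACOn_of_continuous_speed (hv : Continuous v) (hv0 : ∀ t, 0 ≤ v t)
    (hγ : ContinuousOn γ (Icc a b))
    (h : ∀ t ∈ Icc a b, Tendsto (fun s => dist (γ s) (γ t) / |s - t|) (𝓝[Icc a b \ {t}] t)
      (𝓝 (v t))) : IsACOn γ v a b where
  nonneg := hv0
  integrable := hv.intervalIntegrable _ _
  speed_ae := by
    refine Eventually.of_forall fun t ht => ?_
    have hmap : Tendsto (fun s : ℝ => t + s) (𝓝[≠] 0) (𝓝[Icc a b \ {t}] t) := by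
      have h0 : Tendsto (fun s : ℝ => t + s) (𝓝[≠] 0) (𝓝 t) := by
        simpa using ((continuous_const_add t).tendsto 0).mono_left
          (nhdsWithin_le_nhds (s := {0}ᶜ))
      refine tendsto_nhdsWithin_iff.2 ⟨h0, ?_⟩
      filter_upwards [h0.eventually (Icc_mem_nhds ht.1 ht.2), self_mem_nhdsWithin] with s hs hs'
      exact ⟨hs, by simpa using hs'⟩
    simpa [Function.comp_def] using (h t (Ioo_subset_Icc_self ht)).comp hmap
  dist_le s t hs hst ht := by
    have hsub : Icc s t ⊆ Icc a b := Icc_subset_Icc hs ht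
    refine image_le_of_liminf_slope_right_le_deriv_boundary
      (f := fun u => dist (γ s) (γ u)) (B := fun u => ∫ r in s..u, v r) (B' := v)
      (a := s) (b := t) ?_ (by simp) ?_ ?_ ?_ ⟨hst, le_rfl⟩
    · have := hγ.mono hsub
      fun_prop
    · exact (intervalIntegral.continuous_primitive
        (fun p q => hv.intervalIntegrable p q) s).continuousOn
    · exact fun u _ => (hv.integral_hasStrictDerivAt s u).hasDerivAt.hasDerivWithinAt
    · intro u hu r hr
      have hle : 𝓝[>] u ≤ 𝓝[Icc a b \ {u}] u := by
        refine nhdsWithin_le_of_mem ?_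
        filter_upwards [Ioc_mem_nhdsGT hu.2] with p hp
        exact ⟨hsub ⟨hu.1.trans hp.1.le, hp.2⟩, hp.1.ne'⟩
      have hev := ((h u (hsub (Ico_subset_Icc_self hu))).mono_left hle).eventually
        (gt_mem_nhds hr)
      refine Eventually.frequently ?_
      filter_upwards [hev, self_mem_nhdsWithin] with p hp hup
      refine lt_of_le_of_lt ?_ hp
      have hpos : 0 < p - u := sub_pos.2 hup
      rw [slope_def_field, abs_of_pos hpos]
      gcongr
      linarith [dist_triangle (γ s) (γ u) (γ p), dist_comm (γ u) (γ p)]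

theorem HasCurvesOfNearlyMinimalLength.exists_wLength_eq_conformalDist [CompleteSpace X]
    [LocallyCompactSpace X] (hX : HasCurvesOfNearlyMinimalLength X) {w : X → ℝ}
    (hw : Continuous w) {m M : ℝ} (hm : ∀ x, m ≤ w x) (hM : ∀ x, w x ≤ M) (a b : X) :
    ∃ c : ACWithSpeed X (fun p q => dist p q), c.toFun 0 = a ∧ c.toFun 1 = b ∧
      wLength (fun p q => dist p q) w c = conformalDist w a b := by
  obtain ⟨g, hg0, hg1, hg⟩ := hX.exists_geodesic hw hm hM a b
  set L := conformalDist w a b with hL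
  have hexp := hX.isACConnected.exp_mul_dist_le_conformalDist hw hm
  have hL0 : 0 ≤ L := le_trans (by positivity) (hexp a b)
  have hdist : ∀ s ∈ Icc (0 : ℝ) 1, ∀ t ∈ Icc (0 : ℝ) 1,
      dist (g s) (g t) ≤ (Real.exp m)⁻¹ * L * dist s t := by
    have aux : ∀ s ∈ Icc (0 : ℝ) 1, ∀ t ∈ Icc (0 : ℝ) 1, s ≤ t →
        dist (g s) (g t) ≤ (Real.exp m)⁻¹ * L * dist s t := by
      intro s hs t ht hst
      rw [dist_comm s t, Real.dist_eq, abs_of_nonneg (sub_nonneg.2 hst), mul_assoc,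
        ← hg s t hs.1 hst ht.2, ← div_eq_inv_mul, le_div_iff₀' (Real.exp_pos _)]
      exact hexp _ _
    intro s hs t ht
    rcases le_total s t with hst | hst
    · exact aux s hs t ht hst
    · rw [dist_comm, dist_comm s t]
      exact aux t ht s hs hst
  have hgc : ContinuousOn g (Icc 0 1) :=
    (LipschitzOnWith.of_dist_le_mul (K := ⟨(Real.exp m)⁻¹ * L, by positivity⟩) hdist).continuousOn
  set γ : ℝ → X := fun t => g (max 0 (min 1 t)) with hγdef
  have hγ : EqOn γ g (Icc 0 1) := fun t ht => by simp [hγdef, ht.1, ht.2]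
  have hγc : Continuous γ := hgc.comp_continuous (by fun_prop)
    fun t => ⟨le_max_left _ _, max_le zero_le_one (min_le_left _ _)⟩
  have hAC : IsACOn γ (fun t => L * Real.exp (-w (γ t))) 0 1 := by
    refine isACOn_of_continuous_speed (by fun_prop) (fun t => by positivity)
      hγc.continuousOn fun t ht => ?_
    refine tendsto_dist_div_of_conformalDist_eq ht hγc.continuousWithinAt
      (fun ε hε => hX.exists_ball_conformalDist_bounds hw hm (γ t) hε) fun s hs u hu hsu => ?_
    rw [hγ hs, hγ hu]
    exact hg s u hs.1 hsu hu.2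
  refine ⟨hAC.toACWithSpeed, ?_, ?_, ?_⟩
  · exact (hγ (by simp)).trans hg0
  · exact (hγ (by simp)).trans hg1
  · simp [wLength, IsACOn.toACWithSpeed, mul_assoc, ← Real.exp_add]

theorem HasCurvesOfNearlyMinimalLength.conformalDist_complete [CompleteSpace X]
    (hX : HasCurvesOfNearlyMinimalLength X) {w : X → ℝ}
    (hw : Continuous w) {m M : ℝ} (hm : ∀ x, m ≤ w x) (hM : ∀ x, w x ≤ M) (u : ℕ → X)
    (hu : ∀ ε : ℝ, 0 < ε → ∃ N : ℕ, ∀ m n : ℕ, N ≤ m → N ≤ n →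
      conformalDist w (u m) (u n) < ε) :
    ∃ p : X, ∀ ε : ℝ, 0 < ε → ∃ N : ℕ, ∀ n : ℕ, N ≤ n → conformalDist w (u n) p < ε := by
  have hcauchy : CauchySeq u := by
    refine Metric.cauchySeq_iff.2 fun ε hε => ?_
    obtain ⟨N, hN⟩ := hu (Real.exp m * ε) (by positivity)
    refine ⟨N, fun k hk l hl => ?_⟩
    exact lt_of_mul_lt_mul_left ((hX.isACConnected.exp_mul_dist_le_conformalDist hw hm _ _).trans_lt
      (hN k l hk hl)) (Real.exp_nonneg _)
  obtain ⟨p, hp⟩ := cauchySeq_tendsto_of_complete hcauchy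
  refine ⟨p, fun ε hε => ?_⟩
  obtain ⟨N, hN⟩ := Metric.tendsto_atTop.1 hp (ε / Real.exp M) (by positivity)
  refine ⟨N, fun n hn => (hX.conformalDist_le_exp_mul_dist hw hM _ _).trans_lt ?_⟩
  rw [← lt_div_iff₀' (Real.exp_pos _)]
  exact hN n hn

end Curves

theorem stmt4 {X : Type*} [MetricSpace X] [CompleteSpace X] [LocallyCompactSpace X]
    (hlen : ∀ a b : X, dist a b = lengthDist (fun p q => dist p q) a b)
    (w : X → ℝ) (hw : Continuous w) (hb : ∃ m M : ℝ, ∀ x, m ≤ w x ∧ w x ≤ M) :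
    -- completeness of (X, d') where d' is the conformal distance
    (∀ u : ℕ → X,
      (∀ ε : ℝ, 0 < ε → ∃ N : ℕ, ∀ m n : ℕ, N ≤ m → N ≤ n →
        confDist (fun p q => dist p q) w (u m) (u n) < ε) →
      ∃ p : X, ∀ ε : ℝ, 0 < ε → ∃ N : ℕ, ∀ n : ℕ, N ≤ n →
        confDist (fun p' q => dist p' q) w (u n) p < ε) ∧
    -- (X, d') is geodesic: any two points are joined by a curve whose weighted length
    -- equals their conformal distance
    (∀ a b : X, ∃ c : ACWithSpeed X (fun p q => dist p q),
      c.toFun 0 = a ∧ c.toFun 1 = b ∧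
      wLength (fun p q => dist p q) w c = confDist (fun p q => dist p q) w a b) := by
  obtain ⟨m, M, hmM⟩ := hb
  have hX := hasCurvesOfNearlyMinimalLength_of_lengthDist hlen
  exact ⟨hX.conformalDist_complete hw (fun x => (hmM x).1) fun x => (hmM x).2,
    hX.exists_wLength_eq_conformalDist hw (fun x => (hmM x).1) fun x => (hmM x).2⟩
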